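/- Let H : C(X,E) → C(Y,E) be strongly subadditive, separating and strongly pointwise subadditive with H(1_{e₀})(y) ≠ 0 for all y ∈ Y and support map h : Y → X. If H is continuous at 0, then H is a continuous composition map; that is, H is continuous, h is continuous, and Hf(y) = H(1_{f(h(y))})(y) for all f ∈ C(X,E) and y ∈ Y. -/

import Mathlib

open Set

variable {X Y E : Type*} [TopologicalSpace X] [CompactSpace X] [T2Space X]
  [TopologicalSpace Y] [CompactSpace Y] [T2Space Y]
  [NormedRing E] [NormedAlgebra ℂ E] [CompleteSpace E]

/-- The cozero set of a continuous function. -/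
def coz (f : C(X, E)) : Set X := {x | f x ≠ 0}

/-- `H` is separating. -/
def Separating (H : C(X, E) → C(Y, E)) : Prop :=
  ∀ f g : C(X, E), (∀ x : X, ‖f x‖ * ‖g x‖ = 0) → ∀ y : Y, ‖H f y‖ * ‖H g y‖ = 0

/-- `H` is pointwise subadditive. -/
def PointwiseSubadditive (H : C(X, E) → C(Y, E)) : Prop :=
  ∀ f g : C(X, E), ∀ y : Y, ‖H (f + g) y‖ ≤ ‖H f y‖ + ‖H g y‖

/-- `H` is subadditive (with respect to supremum norms). -/
def SubadditiveMap (H : C(X, E) → C(Y, E)) : Prop :=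
  ∀ f g : C(X, E), ‖H (f + g)‖ ≤ ‖H f‖ + ‖H g‖

/-- `H` is strongly subadditive. -/
def StronglySubadditive (H : C(X, E) → C(Y, E)) : Prop :=
  SubadditiveMap H ∧ ∃ M > (0 : ℝ), ∀ f : C(X, E), ∃ ε > (0 : ℝ),
    ∀ g : C(X, E), ‖f - g‖ < ε → ‖H f - H g‖ ≤ M * ‖H (f - g)‖

/-- `U` is a vanishing set for `ŷ ∘ H`. -/
def IsVanishingSet (H : C(X, E) → C(Y, E)) (y : Y) (U : Set X) : Prop :=
  IsOpen U ∧ ∀ f : C(X, E), coz f ⊆ U → H f y = 0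

/-- The support of `ŷ ∘ H` : the complement of the union of all vanishing sets. -/
def suppSet (H : C(X, E) → C(Y, E)) (y : Y) : Set X :=
  (⋃ U ∈ {U : Set X | IsVanishingSet H y U}, U)ᶜ

/-- `H` is strongly pointwise subadditive with respect to a support map `h`. -/
def StronglyPointwiseSubadditive (H : C(X, E) → C(Y, E)) (h : Y → X) : Prop :=
  ∀ y : Y, ∃ M > (0 : ℝ), ∀ c : E, ∃ δ > (0 : ℝ), ∀ f g : C(X, E),
    f (h y) = c → ‖f (h y) - g (h y)‖ < δ →
      ‖H f y - H g y‖ ≤ M * ‖H (f - g) y‖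

/-- `H` is detaching. -/
def Detaching (H : C(X, E) → C(Y, E)) : Prop :=
  ∀ y y' : Y, y ≠ y' → ∃ f g : C(X, E),
    coz f ∩ coz g = ∅ ∧ ‖H f y‖ * ‖H g y'‖ ≠ 0

/-- `H` is norm-bounded. -/
def NormBounded (H : C(X, E) → C(Y, E)) : Prop :=
  ∃ D > (0 : ℝ), ∀ f : C(X, E), ‖H f‖ ≤ D * ‖f‖

/-- `H` is `1_{e₀}`-bounded. -/
def OneBounded (H : C(X, E) → C(Y, E)) : Prop :=
  ∃ D > (0 : ℝ), ∀ e : E,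
    ‖H (ContinuousMap.const X e)‖ ≤ D * ‖H (ContinuousMap.const X (1 : E))‖ * ‖e‖

omit [CompactSpace X] [T2Space X] [CompactSpace Y] [T2Space Y] [NormedAlgebra ℂ E]
  [CompleteSpace E] in
/-- A point of the support has, in each of its neighbourhoods, the cozero set of a function that
`H` does not annihilate at `y`. -/
lemma exists_coz_subset_of_mem_suppSet {H : C(X, E) → C(Y, E)} {y : Y} {x : X}
    (hx : x ∈ suppSet H y) {U : Set X} (hU : IsOpen U) (hxU : x ∈ U) :
    ∃ g : C(X, E), coz g ⊆ U ∧ H g y ≠ 0 := by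
  by_contra! hg
  exact hx (mem_biUnion (show U ∈ {U | IsVanishingSet H y U} from ⟨hU, hg⟩) hxU)

omit [CompactSpace X] [T2Space X] [CompactSpace Y] [T2Space Y] [NormedAlgebra ℂ E]
  [CompleteSpace E] in
/-- A separating map annihilates at `y` every function vanishing near a point of the support. -/
lemma Separating.apply_eq_zero_of_eqOn_zero {H : C(X, E) → C(Y, E)} (hsep : Separating H)
    {y : Y} {x : X} (hx : x ∈ suppSet H y) {U : Set X} (hU : IsOpen U) (hxU : x ∈ U)
    {f : C(X, E)} (hf : ∀ z ∈ U, f z = 0) : H f y = 0 := by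
  obtain ⟨g, hgU, hg⟩ := exists_coz_subset_of_mem_suppSet hx hU hxU
  have hfg : ∀ z, ‖f z‖ * ‖g z‖ = 0 := fun z ↦ by
    by_cases hz : g z = 0
    · simp [hz]
    · simp [hf z (hgU hz)]
  simpa [hg] using hsep f g hfg y

omit [CompactSpace X] [T2Space X] [CompactSpace Y] [T2Space Y] [NormedAlgebra ℂ E]
  [CompleteSpace E] in
/-- A separating map sends `0` to `0`. -/
lemma Separating.map_zero {H : C(X, E) → C(Y, E)} (hsep : Separating H) : H 0 = 0 := by
  ext y
  simpa using hsep 0 0 (by simp) y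

omit [T2Space X] [T2Space Y] [NormedAlgebra ℂ E] [CompleteSpace E] in
/-- A strongly subadditive separating map that is continuous at `0` is continuous. -/
lemma StronglySubadditive.continuous {H : C(X, E) → C(Y, E)} (hss : StronglySubadditive H)
    (hsep : Separating H) (h0 : ContinuousAt H 0) : Continuous H := by
  obtain ⟨-, M, hM, hH⟩ := hss
  rw [Metric.continuousAt_iff] at h0
  rw [Metric.continuous_iff]
  intro f r hr
  obtain ⟨ε, hε, hf⟩ := hH f
  obtain ⟨η, hη, hη'⟩ := h0 (r / M) (by positivity)
  refine ⟨min ε η, lt_min hε hη, fun g hg ↦ ?_⟩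
  rw [dist_comm, dist_eq_norm] at hg ⊢
  have hsmall : ‖H (f - g)‖ < r / M := by
    simpa [hsep.map_zero] using
      hη' (x := f - g) (by simpa using hg.trans_le (min_le_right ε η))
  calc ‖H f - H g‖ ≤ M * ‖H (f - g)‖ := hf g (hg.trans_le (min_le_left ε η))
    _ < r := by rwa [lt_div_iff₀' hM] at hsmall

omit [T2Space X] [CompleteSpace E] in
/-- Every continuous function can be uniformly approximated by continuous functions vanishing
wherever it is small. -/
lemma exists_norm_sub_lt_forall_eq_zero (f : C(X, E)) {ε : ℝ} (hε : 0 < ε) :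
    ∃ g : C(X, E), ‖f - g‖ < ε ∧ ∃ δ > (0 : ℝ), ∀ x, ‖f x‖ < δ → g x = 0 := by
  let φ : ℝ → ℝ := fun t ↦ min 1 (max 0 (t / (ε / 4) - 1))
  have hφ : Continuous φ := by fun_prop
  refine ⟨⟨fun x ↦ (φ ‖f x‖ : ℂ) • f x, by fun_prop⟩, ?_, ε / 4, by positivity, fun x hx ↦ ?_⟩
  · refine ((ContinuousMap.norm_le _ (by positivity : 0 ≤ ε / 2)).2 fun x ↦ ?_).trans_lt
      (by linarith)
    have hφ0 : 0 ≤ φ ‖f x‖ := le_min zero_le_one (le_max_left _ _)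
    have hφ1 : φ ‖f x‖ ≤ 1 := min_le_left _ _
    have hnorm : ‖f x - (φ ‖f x‖ : ℂ) • f x‖ = (1 - φ ‖f x‖) * ‖f x‖ := by
      have : f x - (φ ‖f x‖ : ℂ) • f x = ((1 - φ ‖f x‖ : ℝ) : ℂ) • f x := by
        push_cast
        rw [sub_smul, one_smul]
      rw [this, norm_smul, Complex.norm_real, Real.norm_of_nonneg (by linarith)]
    change ‖f x - (φ ‖f x‖ : ℂ) • f x‖ ≤ ε / 2
    rw [hnorm]
    rcases le_total ‖f x‖ (ε / 2) with hx | hx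
    · nlinarith [norm_nonneg (f x)]
    · have h2 : 2 ≤ ‖f x‖ / (ε / 4) := by
        rw [le_div_iff₀ (by positivity)]
        linarith
      have : φ ‖f x‖ = 1 := min_eq_left (le_max_of_le_right (by linarith))
      rw [this, sub_self, zero_mul]
      positivity
  · have h1 : ‖f x‖ / (ε / 4) < 1 := by rwa [div_lt_one (by positivity)]
    have : φ ‖f x‖ = 0 := by
      simp only [φ]
      rw [max_eq_left (by linarith), min_eq_right zero_le_one]
    simp [this]

omit [T2Space X] [CompactSpace Y] [T2Space Y] [CompleteSpace E] in
/-- A continuous separating map annihilates at `y` every function vanishing at a point of the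
support. -/
lemma Separating.apply_eq_zero {H : C(X, E) → C(Y, E)} (hsep : Separating H) (hH : Continuous H)
    {y : Y} {x : X} (hx : x ∈ suppSet H y) {f : C(X, E)} (hf : f x = 0) : H f y = 0 := by
  by_contra hne
  have hcont : Continuous fun g : C(X, E) ↦ H g y := (continuous_eval_const y).comp hH
  obtain ⟨ε, hε, hball⟩ := Metric.isOpen_iff.1 (isOpen_ne.preimage hcont) f hne
  obtain ⟨g, hfg, δ, hδ, hg⟩ := exists_norm_sub_lt_forall_eq_zero f hε
  refine hball (show g ∈ Metric.ball f ε by rwa [Metric.mem_ball, dist_comm, dist_eq_norm]) ?_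
  exact hsep.apply_eq_zero_of_eqOn_zero hx
    (isOpen_lt (f := fun z ↦ ‖f z‖) (g := fun _ ↦ δ) (by fun_prop) (by fun_prop))
    (by simpa [hf] using hδ) hg

/-- a strongly subadditive, separating, strongly pointwise
subadditive map continuous at `0` is a continuous composition map. -/
theorem stmt_18 (H : C(X, E) → C(Y, E))
    (hss : StronglySubadditive H)
    (hsep : Separating H)
    (hsub : PointwiseSubadditive H)
    (hone : ∀ y : Y, H (ContinuousMap.const X (1 : E)) y ≠ 0)
    (h : Y → X) (hsupp : ∀ y : Y, suppSet H y = {h y})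
    (hstrong : StronglyPointwiseSubadditive H h)
    (h0 : ContinuousAt H 0) :
    Continuous H ∧ Continuous h ∧
      ∀ (f : C(X, E)) (y : Y), H f y = H (ContinuousMap.const X (f (h y))) y := by
  have hH : Continuous H := hss.continuous hsep h0
  have hmem : ∀ y, h y ∈ suppSet H y := fun y ↦ by simp [hsupp y]
  refine ⟨hH, ?_, fun f y ↦ ?_⟩
  · refine continuous_iff_continuousAt.2 fun y ↦ (nhds_basis_opens (h y)).tendsto_right_iff.2 ?_
    rintro U ⟨hyU, hU⟩
    obtain ⟨f, hfU, hf⟩ := exists_coz_subset_of_mem_suppSet (hmem y) hU hyU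
    filter_upwards [(H f).continuous.continuousAt.eventually_ne hf] with z hz
    exact hfU fun hfz ↦ hz (hsep.apply_eq_zero hH (hmem z) hfz)
  · obtain ⟨M, -, hM⟩ := hstrong y
    obtain ⟨δ, hδ, hfg⟩ := hM (f (h y))
    have hle := hfg f (ContinuousMap.const X (f (h y))) rfl (by simpa using hδ)
    have hzero : H (f - ContinuousMap.const X (f (h y))) y = 0 :=
      hsep.apply_eq_zero hH (hmem y) (by simp)
    rw [hzero, norm_zero, mul_zero] at hle
    exact sub_eq_zero.1 (norm_le_zero_iff.1 hle)
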